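/- Let V be a type, r : V → V → Prop, and occ : ℕ → Set V a time-indexed family of occupied locations (locations occupied by higher-priority agents at each time). Define the step relation on V × ℕ by step (v, t) (v', t') := r v v' ∧ t' = t + 1 ∧ v' ∉ occ (t + 1). Then for all u v : V and n : ℕ, (v, n) is reachable from (u, 0) under the reflexive-transitive closure of step if and only if there is a walk of length exactly n from u to v in r, i.e., a function x : Fin (n+1) → V with x 0 = u, x n = v, r (x i) (x (i+1)) for every i < n, that additionally avoids all occupied locations at positive times: x i ∉ occ i for every i with 1 ≤ i ≤ n. -/

import Mathlib

/-- Reachability in the occupancy-restricted time-expanded graph corresponds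
exactly to walks that avoid all occupied locations at positive times. -/
theorem timeExpanded_occ_reachable_iff_walk {V : Type*} (r : V → V → Prop)
    (occ : ℕ → Set V) :
    ∀ (u v : V) (n : ℕ),
      Relation.ReflTransGen
        (fun p q : V × ℕ => r p.1 q.1 ∧ q.2 = p.2 + 1 ∧ q.1 ∉ occ (p.2 + 1))
        (u, 0) (v, n) ↔
      ∃ x : Fin (n + 1) → V, x 0 = u ∧ x (Fin.last n) = v ∧
        (∀ i : Fin n, r (x i.castSucc) (x i.succ)) ∧
        (∀ i : Fin (n + 1), 1 ≤ (i : ℕ) → x i ∉ occ (i : ℕ)) := by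
  intro u v n
  constructor
  · intro h
    generalize hq : (v, n) = q at h
    induction h generalizing v n with
    | refl =>
      obtain ⟨rfl, rfl⟩ := Prod.mk.inj hq
      refine ⟨fun _ => v, rfl, rfl, fun i => i.elim0, fun i hi => ?_⟩
      omega
    | @tail p q _ hstep ih =>
      obtain ⟨w, m⟩ := p
      subst hq
      obtain ⟨hr, hm, hocc⟩ := hstep
      dsimp only at hr hm hocc
      subst hm
      obtain ⟨x, hx0, hxm, hxr, hxo⟩ := ih w m rfl
      refine ⟨Fin.snoc (α := fun _ => V) x v, ?_, Fin.snoc_last .., fun i => ?_, fun i => ?_⟩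
      · rw [← Fin.castSucc_zero, Fin.snoc_castSucc, hx0]
      · induction i using Fin.lastCases with
        | last => rwa [Fin.snoc_castSucc, Fin.succ_last, Fin.snoc_last, hxm]
        | cast j =>
          rw [Fin.snoc_castSucc, Fin.succ_castSucc, Fin.snoc_castSucc]
          exact hxr j
      · induction i using Fin.lastCases with
        | last => simpa using hocc
        | cast j => simpa using hxo j
  · rintro ⟨x, rfl, rfl, hr, hocc⟩
    have reach (i : Fin (n + 1)) : Relation.ReflTransGen
        (fun p q : V × ℕ => r p.1 q.1 ∧ q.2 = p.2 + 1 ∧ q.1 ∉ occ (p.2 + 1))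
        (x 0, 0) (x i, (i : ℕ)) := by
      induction i using Fin.induction with
      | zero => exact .refl
      | succ i ih => exact ih.tail ⟨hr i, rfl, hocc i.succ (by simp)⟩
    exact reach (Fin.last n)
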